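/- Let G be an abelian group, φ : G → G a group endomorphism, k a positive integer, and suppose that G = T(φ,F) for some finitely generated subgroup F of G and that ent̃(φ) < ∞. Then there exists a finitely generated subgroup H of G which is both φ-inert and φ^k-inert, with G = T(φ,H) = T(φ^k,H), such that ent̃(φ) = ent̃(φ,H) and ent̃(φ^k) = ent̃(φ^k,H); consequently ent̃(φ^k) = k · ent̃(φ). -/

import Mathlib

open Filter Topology ENNReal

variable {G : Type*}

/-- The `n`-th partial `φ`-trajectory of a subgroup `H`:
`T_n(φ,H) = H + φ(H) + ... + φ^{n-1}(H)`. -/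
noncomputable def traj [AddCommGroup G] (φ : AddMonoid.End G) (H : AddSubgroup G) (n : ℕ) :
    AddSubgroup G :=
  ⨆ i ∈ Finset.range n, H.map (φ ^ i)

/-- `H` is `φ`-inert if `(H + φ(H))/H` is finite. -/
def IsInert [AddCommGroup G] (φ : AddMonoid.End G) (H : AddSubgroup G) : Prop :=
  Finite (↥(H ⊔ H.map φ) ⧸ H.addSubgroupOf (H ⊔ H.map φ))

/-- The sequence `n ↦ log |T_n(φ,H)/H| / n`. -/
noncomputable def entFun [AddCommGroup G] (φ : AddMonoid.End G) (H : AddSubgroup G) (n : ℕ) : ℝ :=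
  Real.log (Nat.card (↥(traj φ H n) ⧸ H.addSubgroupOf (traj φ H n))) / n

/-- The intrinsic entropy of `φ` with respect to `H`: the limit of `entFun φ H`. -/
noncomputable def entWrt [AddCommGroup G] (φ : AddMonoid.End G) (H : AddSubgroup G) : ℝ :=
  limUnder atTop (entFun φ H)

/-- The intrinsic algebraic entropy of `φ`. -/
noncomputable def intrinsicEnt [AddCommGroup G] (φ : AddMonoid.End G) : ℝ≥0∞ :=
  ⨆ (H : AddSubgroup G) (_ : IsInert φ H), ENNReal.ofReal (entWrt φ H)

/-- The `φ`-trajectory of `H`: `T(φ,H) = ⋃_{n ≥ 1} T_n(φ,H)`. -/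
noncomputable def trajAll [AddCommGroup G] (φ : AddMonoid.End G) (H : AddSubgroup G) :
    AddSubgroup G :=
  ⨆ n : ℕ, traj φ H (n + 1)

open Polynomial

section Trajectory

variable [AddCommGroup G]

theorem traj_le_iff {φ : AddMonoid.End G} {H K : AddSubgroup G} {n : ℕ} :
    traj φ H n ≤ K ↔ ∀ i < n, H.map (φ ^ i) ≤ K := by
  simp [traj]

theorem map_pow_le_traj (φ : AddMonoid.End G) (H : AddSubgroup G) {i n : ℕ} (h : i < n) :
    H.map (φ ^ i) ≤ traj φ H n :=
  traj_le_iff.1 le_rfl i h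

theorem map_map_pow (φ : AddMonoid.End G) (H : AddSubgroup G) (i j : ℕ) :
    (H.map (φ ^ i)).map (φ ^ j) = H.map (φ ^ (i + j)) :=
  (AddSubgroup.map_map _ _ _).trans
    (congrArg (fun f : AddMonoid.End G => H.map f) (add_comm i j ▸ pow_add φ j i).symm)

theorem map_map_eq (φ : AddMonoid.End G) (H : AddSubgroup G) (i : ℕ) :
    (H.map (φ ^ i)).map φ = H.map (φ ^ (i + 1)) :=
  (AddSubgroup.map_map _ _ _).trans
    (congrArg (fun f : AddMonoid.End G => H.map f) (pow_succ' φ i).symm)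

theorem map_pow_zero (φ : AddMonoid.End G) (H : AddSubgroup G) : H.map (φ ^ 0) = H :=
  (congrArg (fun f : AddMonoid.End G => H.map f) (pow_zero φ)).trans (AddSubgroup.map_id H)

theorem traj_mono (φ : AddMonoid.End G) (H : AddSubgroup G) : Monotone (traj φ H) :=
  fun _ _ h => traj_le_iff.2 fun _ hi => map_pow_le_traj φ H (hi.trans_le h)

theorem traj_mono_left (φ : AddMonoid.End G) {H K : AddSubgroup G} (h : H ≤ K) (n : ℕ) :
    traj φ H n ≤ traj φ K n :=
  traj_le_iff.2 fun _ hi => (AddSubgroup.map_mono h).trans (map_pow_le_traj φ K hi)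

theorem le_traj (φ : AddMonoid.End G) (H : AddSubgroup G) {n : ℕ} (h : 0 < n) :
    H ≤ traj φ H n :=
  (map_pow_zero φ H).ge.trans (map_pow_le_traj φ H h)

theorem traj_one (φ : AddMonoid.End G) (H : AddSubgroup G) : traj φ H 1 = H :=
  le_antisymm (traj_le_iff.2 fun i hi => by
    obtain rfl := Nat.lt_one_iff.1 hi
    exact (map_pow_zero φ H).le) (le_traj φ H one_pos)

theorem traj_succ (φ : AddMonoid.End G) (H : AddSubgroup G) (n : ℕ) :
    traj φ H (n + 1) = H ⊔ (traj φ H n).map φ := by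
  apply le_antisymm
  · refine traj_le_iff.2 fun i hi => ?_
    cases i with
    | zero => exact le_sup_of_le_left (map_pow_zero φ H).le
    | succ i =>
      refine le_sup_of_le_right ?_
      exact (map_map_eq φ H i).ge.trans
        (AddSubgroup.map_mono (map_pow_le_traj φ H (by omega)))
  · refine sup_le (le_traj φ H n.succ_pos) (AddSubgroup.map_le_iff_le_comap.2 ?_)
    refine traj_le_iff.2 fun i hi => AddSubgroup.map_le_iff_le_comap.1 ?_
    exact (map_map_eq φ H i).le.trans (map_pow_le_traj φ H (by omega))

theorem traj_succ' (φ : AddMonoid.End G) (H : AddSubgroup G) (n : ℕ) :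
    traj φ H (n + 1) = traj φ H n ⊔ H.map (φ ^ n) := by
  apply le_antisymm
  · refine traj_le_iff.2 fun i hi => ?_
    rcases Nat.lt_succ_iff_lt_or_eq.1 hi with h | rfl
    · exact le_sup_of_le_left (map_pow_le_traj φ H h)
    · exact le_sup_right
  · exact sup_le (traj_mono φ H n.le_succ) (map_pow_le_traj φ H n.lt_succ_self)

theorem traj_traj_le (φ : AddMonoid.End G) (H : AddSubgroup G) (m n : ℕ) :
    traj φ (traj φ H m) n ≤ traj φ H (m + n) :=
  traj_le_iff.2 fun i hi => AddSubgroup.map_le_iff_le_comap.2 <| traj_le_iff.2 fun j hj =>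
    AddSubgroup.map_le_iff_le_comap.1 <|
      (map_map_pow φ H j i).le.trans (map_pow_le_traj φ H (by omega))

theorem traj_pow_le (φ : AddMonoid.End G) (H : AddSubgroup G) {k : ℕ} (hk : 0 < k) (n : ℕ) :
    traj (φ ^ k) H n ≤ traj φ H (k * n) :=
  traj_le_iff.2 fun i hi => by
    rw [← pow_mul]
    exact map_pow_le_traj φ H (Nat.mul_lt_mul_of_pos_left hi hk)

theorem traj_mul_le_traj_pow_traj (φ : AddMonoid.End G) (F : AddSubgroup G) {k N : ℕ}
    (hk : 0 < k) (hkN : k ≤ N) (n : ℕ) :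
    traj φ F (k * n) ≤ traj (φ ^ k) (traj φ F N) n :=
  traj_le_iff.2 fun i hi => by
    rw [← Nat.mod_add_div i k, ← map_map_pow, pow_mul]
    refine (AddSubgroup.map_mono (map_pow_le_traj φ F
      ((Nat.mod_lt i hk).trans_le hkN))).trans (map_pow_le_traj _ _ ?_)
    exact Nat.div_lt_of_lt_mul hi

theorem AddSubgroup.FG.map {A : Type*} [AddGroup A] {B : Type*} [AddGroup B]
    {H : AddSubgroup A} (hH : H.FG) (f : A →+ B) : (H.map f).FG := by
  obtain ⟨s, rfl, hs⟩ := (AddSubgroup.fg_iff _).1 hH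
  exact (AddSubgroup.fg_iff _).2 ⟨f '' s, (AddMonoidHom.map_closure f s).symm, hs.image f⟩

theorem traj_fg (φ : AddMonoid.End G) {H : AddSubgroup G} (hH : H.FG) (n : ℕ) :
    (traj φ H n).FG :=
  AddSubgroup.FG.biSup_finset _ _ fun _ _ => hH.map _

theorem traj_le_trajAll (φ : AddMonoid.End G) (H : AddSubgroup G) (n : ℕ) :
    traj φ H n ≤ trajAll φ H :=
  (traj_mono φ H n.le_succ).trans (le_iSup (fun n => traj φ H (n + 1)) n)

theorem exists_le_traj_of_fg {φ : AddMonoid.End G} {H S : AddSubgroup G}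
    (hH : trajAll φ H = ⊤) (hS : S.FG) : ∃ m, S ≤ traj φ H m := by
  obtain ⟨s, rfl⟩ := hS
  have key : ∀ x : G, ∃ m, x ∈ traj φ H m := fun x => by
    have hx : x ∈ trajAll φ H := hH ▸ AddSubgroup.mem_top x
    have hmono : Monotone fun n => traj φ H (n + 1) := fun _ _ h =>
      traj_mono φ H (Nat.succ_le_succ h)
    obtain ⟨n, hn⟩ := (AddSubgroup.mem_iSup_of_directed hmono.directed_le).1 hx
    exact ⟨n + 1, hn⟩
  choose m hm using key
  refine ⟨s.sup m, (AddSubgroup.closure_le _).2 fun x hx => ?_⟩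
  exact traj_mono φ H (Finset.le_sup (f := m) hx) (hm x)

end Trajectory

section RelIndex

variable [AddCommGroup G]

theorem AddSubgroup.relIndex_eq_card_map_mk (K A : AddSubgroup G) :
    K.relIndex A = Nat.card (A.map (QuotientAddGroup.mk' K)) := by
  rw [← AddSubgroup.relIndex_ker, QuotientAddGroup.ker_mk']

theorem AddSubgroup.FG.finite_of_isTorsion {B : AddSubgroup G} (hB : B.FG)
    (h : ∀ b ∈ B, ∃ m : ℕ, m ≠ 0 ∧ m • b = 0) : Finite B := by
  have : AddGroup.FG B := (AddGroup.fg_iff_addSubgroup_fg B).2 hB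
  have : Module.Finite ℤ B := Module.Finite.iff_addGroup_fg.2 inferInstance
  refine Module.finite_of_fg_torsion B fun {b} => ?_
  obtain ⟨m, hm, hmb⟩ := h b b.2
  refine ⟨⟨m, mem_nonZeroDivisors_of_ne_zero (by exact_mod_cast hm)⟩, ?_⟩
  ext
  simpa [Submonoid.smul_def] using hmb

/-- The finite subgroups of a finitely generated abelian group have bounded order. -/
theorem AddSubgroup.FG.exists_card_le {B : AddSubgroup G} (hB : B.FG) :
    ∃ c : ℕ, 0 < c ∧ ∀ A ≤ B, Finite A → Nat.card A ≤ c := by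
  have : AddGroup.FG B := (AddGroup.fg_iff_addSubgroup_fg B).2 hB
  have : Module.Finite ℤ B := Module.Finite.iff_addGroup_fg.2 inferInstance
  have : Module.Finite ℤ (Submodule.torsion ℤ B) := inferInstance
  have : Finite (Submodule.torsion ℤ B) :=
    Module.finite_of_fg_torsion _ (Submodule.torsion_isTorsion (R := ℤ) (M := B))
  refine ⟨Nat.card (Submodule.torsion ℤ B), Nat.card_pos, fun A hA hfin => ?_⟩
  refine Nat.card_le_card_of_injective
    (fun a : A => (⟨⟨a, hA a.2⟩, ?_⟩ : Submodule.torsion ℤ B)) ?_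
  · refine (Submodule.mem_torsion_iff _).2 ⟨⟨Nat.card A, mem_nonZeroDivisors_of_ne_zero
      (by exact_mod_cast Nat.card_pos.ne')⟩, ?_⟩
    have h : Nat.card A • (a : G) = 0 := congrArg Subtype.val (card_nsmul_eq_zero' (x := a))
    apply Subtype.ext
    simp only [Submonoid.smul_def, natCast_zsmul]
    exact h
  · intro a b hab
    exact Subtype.ext (congrArg (fun z : Submodule.torsion ℤ B => ((z : B) : G)) hab)

theorem AddSubgroup.FG.exists_relIndex_le {H : AddSubgroup G} (hH : H.FG) (K : AddSubgroup G) :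
    ∃ c : ℕ, 0 < c ∧ ∀ A ≤ H, K.relIndex A ≤ c := by
  obtain ⟨c, hc, h⟩ := (hH.map (QuotientAddGroup.mk' K)).exists_card_le
  refine ⟨c, hc, fun A hA => ?_⟩
  rw [AddSubgroup.relIndex_eq_card_map_mk]
  rcases finite_or_infinite (A.map (QuotientAddGroup.mk' K)) with hf | hi
  · exact h _ (AddSubgroup.map_mono hA) hf
  · exact Nat.card_eq_zero_of_infinite.trans_le c.zero_le

theorem AddSubgroup.FG.relIndex_ne_zero {B K : AddSubgroup G} (hB : B.FG) {m : ℕ} (hm : m ≠ 0)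
    (h : ∀ b ∈ B, m • b ∈ K) : K.relIndex B ≠ 0 := by
  rw [AddSubgroup.relIndex_eq_card_map_mk]
  have : Finite (B.map (QuotientAddGroup.mk' K)) := by
    refine (hB.map _).finite_of_isTorsion ?_
    rintro _ ⟨b, hb, rfl⟩
    refine ⟨m, hm, ?_⟩
    rw [← map_nsmul]
    exact (QuotientAddGroup.eq_zero_iff _).2 (h b hb)
  exact Nat.card_pos.ne'

theorem AddSubgroup.relIndex_ne_zero_mono {K A B : AddSubgroup G} (hAB : A ≤ B)
    (h : K.relIndex B ≠ 0) : K.relIndex A ≠ 0 :=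
  fun h0 => h (AddSubgroup.relIndex_eq_zero_of_le_right hAB h0)

end RelIndex

section Inert

variable [AddCommGroup G]

theorem isInert_iff_relIndex_map_ne_zero {φ : AddMonoid.End G} {H : AddSubgroup G} :
    IsInert φ H ↔ H.relIndex (H.map φ) ≠ 0 := by
  rw [← AddSubgroup.relIndex_sup_left]
  exact AddSubgroup.index_ne_zero_iff_finite.symm

theorem relIndex_traj_succ_dvd (φ : AddMonoid.End G) (H : AddSubgroup G) (n : ℕ) :
    (traj φ H (n + 1)).relIndex (traj φ H (n + 2)) ∣
      (traj φ H n).relIndex (traj φ H (n + 1)) := by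
  set A := traj φ H n
  set B := traj φ H (n + 1) with hB
  have hAB : A ≤ B := traj_mono φ H n.le_succ
  have h1 : B = H ⊔ A.map φ := traj_succ φ H n
  have h2 : traj φ H (n + 2) = B ⊔ B.map φ :=
    (traj_succ φ H (n + 1)).trans <| le_antisymm (sup_le_sup_right (le_traj φ H n.succ_pos) _) <|
      sup_le (h1.le.trans (sup_le_sup_left (AddSubgroup.map_mono hAB) _)) le_sup_right
  rw [h2, AddSubgroup.relIndex_sup_left]
  have h3 : A.map φ ≤ B := h1 ▸ le_sup_right
  refine (AddSubgroup.relIndex_dvd_of_le_left _ h3).trans ?_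
  refine (AddSubgroup.relIndex_map_map (φ : G →+ G) A B).dvd.trans ?_
  have h4 : B ⊔ AddMonoidHom.ker φ = B ⊔ (A ⊔ AddMonoidHom.ker φ) := by
    rw [← sup_assoc, sup_eq_left.2 hAB]
  rw [h4, AddSubgroup.relIndex_sup_right]
  exact AddSubgroup.relIndex_dvd_of_le_left _ le_sup_left

theorem IsInert.relIndex_traj_succ_ne_zero {φ : AddMonoid.End G} {H : AddSubgroup G}
    (h : IsInert φ H) (n : ℕ) :
    (traj φ H (n + 1)).relIndex (traj φ H (n + 2)) ≠ 0 := by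
  induction n with
  | zero =>
    rw [traj_succ φ H 1, traj_one, AddSubgroup.relIndex_sup_left]
    exact isInert_iff_relIndex_map_ne_zero.1 h
  | succ n ih => exact ne_zero_of_dvd_ne_zero ih (relIndex_traj_succ_dvd φ H (n + 1))

theorem relIndex_traj_succ (φ : AddMonoid.End G) (H : AddSubgroup G) (n : ℕ) :
    H.relIndex (traj φ H (n + 2)) =
      H.relIndex (traj φ H (n + 1)) * (traj φ H (n + 1)).relIndex (traj φ H (n + 2)) :=
  (AddSubgroup.relIndex_mul_relIndex _ _ _ (le_traj φ H n.succ_pos)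
    (traj_mono φ H (n + 1).le_succ)).symm

theorem IsInert.relIndex_traj_ne_zero {φ : AddMonoid.End G} {H : AddSubgroup G}
    (h : IsInert φ H) (n : ℕ) : H.relIndex (traj φ H n) ≠ 0 := by
  refine AddSubgroup.relIndex_ne_zero_mono (traj_mono φ H n.le_succ) ?_
  induction n with
  | zero => simp [traj_one]
  | succ n ih =>
    rw [relIndex_traj_succ]
    exact mul_ne_zero ih (h.relIndex_traj_succ_ne_zero n)

theorem IsInert.pow {φ : AddMonoid.End G} {H : AddSubgroup G} (h : IsInert φ H) (k : ℕ) :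
    IsInert (φ ^ k) H :=
  isInert_iff_relIndex_map_ne_zero.2 <| AddSubgroup.relIndex_ne_zero_mono
    (map_pow_le_traj φ H k.lt_succ_self) (h.relIndex_traj_ne_zero _)

theorem IsInert.log_relIndex_traj {φ : AddMonoid.End G} {H : AddSubgroup G}
    (h : IsInert φ H) (n : ℕ) :
    Real.log (H.relIndex (traj φ H (n + 1))) =
      ∑ i ∈ Finset.range n, Real.log ((traj φ H (i + 1)).relIndex (traj φ H (i + 2))) := by
  induction n with
  | zero => simp [traj_one]
  | succ n ih =>
    rw [Finset.sum_range_succ, ← ih, relIndex_traj_succ, Nat.cast_mul, Real.log_mul]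
    · exact_mod_cast h.relIndex_traj_ne_zero _
    · exact_mod_cast h.relIndex_traj_succ_ne_zero _

theorem entFun_eq (φ : AddMonoid.End G) (H : AddSubgroup G) (n : ℕ) :
    entFun φ H n = Real.log (H.relIndex (traj φ H n)) / n :=
  rfl

theorem tendsto_div_of_tendsto_succ_div {f : ℕ → ℝ} {l : ℝ}
    (h : Tendsto (fun n : ℕ => f (n + 1) / n) atTop (𝓝 l)) :
    Tendsto (fun n : ℕ => f n / n) atTop (𝓝 l) := by
  rw [← tendsto_add_atTop_iff_nat 1]
  have h1 : Tendsto (fun n : ℕ => (n : ℝ) / (n + 1)) atTop (𝓝 1) :=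
    tendsto_natCast_div_add_atTop 1
  have h2 := h.mul h1
  rw [mul_one] at h2
  refine h2.congr' ?_
  filter_upwards [eventually_gt_atTop 0] with n hn
  have : (n : ℝ) ≠ 0 := by exact_mod_cast hn.ne'
  push_cast
  field_simp

theorem tendsto_mul_add_div {f : ℕ → ℝ} {l : ℝ}
    (h : Tendsto (fun n : ℕ => f n / n) atTop (𝓝 l)) {k : ℕ} (hk : 0 < k) (m : ℕ) :
    Tendsto (fun n : ℕ => f (k * n + m) / n) atTop (𝓝 (k * l)) := by
  have ht : Tendsto (fun n : ℕ => k * n + m) atTop atTop :=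
    tendsto_atTop_mono (fun n => (Nat.le_mul_of_pos_left n hk).trans (Nat.le_add_right _ m))
      tendsto_id
  have h1 : Tendsto (fun n : ℕ => (k : ℝ) + m / n) atTop (𝓝 (k + 0)) :=
    tendsto_const_nhds.add (tendsto_const_div_atTop_nhds_zero_nat _)
  rw [add_zero] at h1
  refine (h1.mul (h.comp ht)).congr' ?_
  filter_upwards [eventually_gt_atTop 0] with n hn
  have h0 : (n : ℝ) ≠ 0 := by exact_mod_cast hn.ne'
  have h2 : (k * n + m : ℝ) ≠ 0 := by positivity
  simp only [Function.comp_apply]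
  push_cast
  field_simp

theorem IsInert.tendsto_entFun {φ : AddMonoid.End G} {H : AddSubgroup G} (h : IsInert φ H) :
    Tendsto (entFun φ H) atTop (𝓝 (entWrt φ H)) := by
  refine tendsto_nhds_limUnder ?_
  let u : ℕ → ℝ := fun i => Real.log ((traj φ H (i + 1)).relIndex (traj φ H (i + 2)))
  have hu : Antitone u := antitone_nat_of_succ_le fun n => by
    refine Real.log_le_log ?_ ?_
    · exact_mod_cast Nat.pos_of_ne_zero (h.relIndex_traj_succ_ne_zero (n + 1))
    · exact_mod_cast Nat.le_of_dvd (Nat.pos_of_ne_zero (h.relIndex_traj_succ_ne_zero n))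
        (relIndex_traj_succ_dvd φ H (n + 1))
  have hb : BddBelow (Set.range u) := ⟨0, by
    rintro _ ⟨n, rfl⟩
    exact Real.log_natCast_nonneg _⟩
  have hc := (tendsto_atTop_ciInf hu hb).cesaro
  refine ⟨_, tendsto_div_of_tendsto_succ_div (f := fun n => Real.log (H.relIndex (traj φ H n)))
    (hc.congr fun n => ?_)⟩
  rw [h.log_relIndex_traj, div_eq_inv_mul]

theorem IsInert.tendsto_log_relIndex_traj {φ : AddMonoid.End G} {H : AddSubgroup G}
    (h : IsInert φ H) {k : ℕ} (hk : 0 < k) (m : ℕ) :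
    Tendsto (fun n : ℕ => Real.log (H.relIndex (traj φ H (k * n + m))) / n) atTop
      (𝓝 (k * entWrt φ H)) :=
  tendsto_mul_add_div (f := fun n => Real.log (H.relIndex (traj φ H n))) h.tendsto_entFun hk m

theorem IsInert.exists_fg_traj_le {φ : AddMonoid.End G} {K : AddSubgroup G} (h : IsInert φ K) :
    ∃ S ≤ K, S.FG ∧ ∀ n, traj φ K n ≤ K ⊔ traj φ S n := by
  have h0 := isInert_iff_relIndex_map_ne_zero.1 h
  rw [AddSubgroup.relIndex_eq_card_map_mk] at h0
  have hfin : Finite ((K.map φ).map (QuotientAddGroup.mk' K)) := Nat.finite_of_card_ne_zero h0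
  have himg : ((fun x => QuotientAddGroup.mk' K (φ x)) '' (K : Set G)).Finite := by
    refine (Set.toFinite ((K.map φ).map (QuotientAddGroup.mk' K) : Set (G ⧸ K))).subset ?_
    rintro _ ⟨x, hx, rfl⟩
    exact ⟨φ x, ⟨x, hx, rfl⟩, rfl⟩
  obtain ⟨s, hsK, hs, himgs⟩ := Set.exists_subset_image_finite_and.1
    ⟨_, subset_rfl, himg, subset_rfl⟩
  have hmap : K.map φ ≤ K ⊔ (AddSubgroup.closure s).map φ := by
    rintro _ ⟨x, hx, rfl⟩
    obtain ⟨y, hy, hxy⟩ := himgs ⟨x, hx, rfl⟩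
    have hsub : -φ y + φ x ∈ K := QuotientAddGroup.eq.1 hxy
    refine AddSubgroup.mem_sup.2 ⟨_, hsub, φ y, ⟨y, AddSubgroup.subset_closure hy, rfl⟩, ?_⟩
    exact neg_add_cancel_comm (φ y) (φ x)
  refine ⟨AddSubgroup.closure s, (AddSubgroup.closure_le K).2 hsK, (AddSubgroup.fg_iff _).2 ⟨s, rfl, hs⟩, fun n => ?_⟩
  induction n with
  | zero => exact (traj_le_iff.2 fun i hi => absurd hi i.not_lt_zero)
  | succ n ih =>
    refine (traj_succ φ K n).le.trans (sup_le le_sup_left ?_)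
    rcases n.eq_zero_or_pos with rfl | hn
    · have h0 : traj φ K 0 ≤ ⊥ := traj_le_iff.2 fun i hi => absurd hi i.not_lt_zero
      exact (AddSubgroup.map_mono h0).trans ((AddSubgroup.map_bot _).le.trans bot_le)
    · refine (AddSubgroup.map_mono ih).trans ((AddSubgroup.map_sup _ _ _).le.trans ?_)
      have hS : (traj φ (AddSubgroup.closure s) n).map φ ≤ traj φ (AddSubgroup.closure s) (n + 1) :=
        le_sup_right.trans (traj_succ φ _ n).ge
      exact sup_le (hmap.trans (sup_le_sup_left
        ((AddSubgroup.map_mono (le_traj φ _ hn)).trans hS) _)) (hS.trans le_sup_right)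

/-- A finitely generated inert subgroup with full trajectory realises the intrinsic entropy. -/
theorem IsInert.entWrt_le {φ : AddMonoid.End G} {H K : AddSubgroup G} (hHfg : H.FG)
    (hH : IsInert φ H) (hHG : trajAll φ H = ⊤) (hK : IsInert φ K) :
    entWrt φ K ≤ entWrt φ H := by
  obtain ⟨S, hSK, hS, hKS⟩ := hK.exists_fg_traj_le
  obtain ⟨m, hm⟩ := exists_le_traj_of_fg hHG hS
  obtain ⟨c, hc, hcH⟩ := hHfg.exists_relIndex_le K
  have hbound : ∀ n, K.relIndex (traj φ K n) ≤ c * H.relIndex (traj φ H (1 * n + m)) := by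
    intro n
    have hTS : traj φ S n ≤ traj φ H (1 * n + m) := by
      rw [one_mul, add_comm]
      exact (traj_mono_left φ hm n).trans (traj_traj_le φ H m n)
    have hHS : H.relIndex (traj φ S n) ≠ 0 :=
      AddSubgroup.relIndex_ne_zero_mono hTS (hH.relIndex_traj_ne_zero _)
    have h0 : K.relIndex (traj φ S n) ≠ 0 :=
      AddSubgroup.relIndex_ne_zero_mono (traj_mono_left φ hSK n) (hK.relIndex_traj_ne_zero _)
    have hKH : (K ⊓ H).relIndex (traj φ S n) ≠ 0 := AddSubgroup.relIndex_inf_ne_zero h0 hHS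
    calc K.relIndex (traj φ K n) ≤ K.relIndex (K ⊔ traj φ S n) :=
          AddSubgroup.relIndex_le_of_le_right (hKS n) (by rwa [AddSubgroup.relIndex_sup_left])
      _ = K.relIndex (traj φ S n) := AddSubgroup.relIndex_sup_left _ _
      _ ≤ (K ⊓ H).relIndex (traj φ S n) := AddSubgroup.relIndex_le_of_le_left inf_le_left hKH
      _ = K.relIndex (H ⊓ traj φ S n) * H.relIndex (traj φ S n) :=
          (AddSubgroup.relIndex_inf_mul_relIndex _ _ _).symm
      _ ≤ c * H.relIndex (traj φ H (1 * n + m)) := Nat.mul_le_mul (hcH _ inf_le_left)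
          (AddSubgroup.relIndex_le_of_le_right hTS (hH.relIndex_traj_ne_zero _))
  have h1 := (tendsto_const_div_atTop_nhds_zero_nat (Real.log c)).add
    (hH.tendsto_log_relIndex_traj one_pos m)
  rw [Nat.cast_one, one_mul, zero_add] at h1
  refine le_of_tendsto_of_tendsto' hK.tendsto_entFun h1 fun n => ?_
  rw [entFun_eq, ← add_div]
  gcongr
  have h2 : (H.relIndex (traj φ H (1 * n + m)) : ℝ) ≠ 0 := by
    exact_mod_cast hH.relIndex_traj_ne_zero _
  rw [← Real.log_mul (by exact_mod_cast hc.ne') h2]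
  refine Real.log_le_log ?_ (by exact_mod_cast hbound n)
  exact_mod_cast Nat.pos_of_ne_zero (hK.relIndex_traj_ne_zero n)

theorem IsInert.intrinsicEnt_eq {φ : AddMonoid.End G} {H : AddSubgroup G} (hHfg : H.FG)
    (hH : IsInert φ H) (hHG : trajAll φ H = ⊤) :
    intrinsicEnt φ = ENNReal.ofReal (entWrt φ H) :=
  le_antisymm (iSup₂_le fun _ hK => ENNReal.ofReal_le_ofReal (hH.entWrt_le hHfg hHG hK))
    (le_iSup₂_of_le H hH le_rfl)

theorem le_trajAll_iff {φ : AddMonoid.End G} {H K : AddSubgroup G} :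
    trajAll φ H ≤ K ↔ ∀ i, H.map (φ ^ i) ≤ K := by
  refine iSup_le_iff.trans ⟨fun h i => (map_pow_le_traj φ H i.lt_succ_self).trans (h i), ?_⟩
  exact fun h n => traj_le_iff.2 fun i _ => h i

theorem trajAll_pow_eq_top {φ : AddMonoid.End G} {F : AddSubgroup G} {k N : ℕ} (hk : 0 < k)
    (hkN : k ≤ N) (hF : trajAll φ F = ⊤) : trajAll (φ ^ k) (traj φ F N) = ⊤ := by
  refine top_le_iff.1 (hF.ge.trans (le_trajAll_iff.2 fun i => ?_))
  refine (map_pow_le_traj φ F (Nat.lt_of_lt_of_le i.lt_succ_self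
    (Nat.le_mul_of_pos_left _ hk))).trans ?_
  exact (traj_mul_le_traj_pow_traj φ F hk hkN (i + 1)).trans (traj_le_trajAll _ _ _)

theorem trajAll_traj_eq_top {φ : AddMonoid.End G} {F : AddSubgroup G} {N : ℕ} (hN : 0 < N)
    (hF : trajAll φ F = ⊤) : trajAll φ (traj φ F N) = ⊤ := by
  simpa using trajAll_pow_eq_top one_pos hN hF

theorem entWrt_pow {φ : AddMonoid.End G} {F : AddSubgroup G} {k N : ℕ} (hk : 0 < k)
    (hkN : k ≤ N) (h : IsInert φ (traj φ F N)) :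
    entWrt (φ ^ k) (traj φ F N) = k * entWrt φ (traj φ F N) := by
  set H := traj φ F N with hH
  have hpow := h.pow k
  refine le_antisymm ?_ ?_
  · refine le_of_tendsto_of_tendsto' hpow.tendsto_entFun
      (h.tendsto_log_relIndex_traj hk 0) fun n => ?_
    rw [entFun_eq]
    gcongr
    · exact_mod_cast Nat.pos_of_ne_zero (hpow.relIndex_traj_ne_zero n)
    · exact AddSubgroup.relIndex_le_of_le_right (traj_pow_le φ H hk n)
        (h.relIndex_traj_ne_zero _)
  · have h1 := hpow.tendsto_log_relIndex_traj one_pos N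
    rw [Nat.cast_one, one_mul] at h1
    refine le_of_tendsto_of_tendsto' (h.tendsto_log_relIndex_traj hk 0) h1 fun n => ?_
    gcongr
    · exact_mod_cast Nat.pos_of_ne_zero (h.relIndex_traj_ne_zero _)
    · refine AddSubgroup.relIndex_le_of_le_right ?_ (hpow.relIndex_traj_ne_zero _)
      refine ((traj_traj_le φ F N _).trans (traj_mono φ F ?_)).trans
        (traj_mul_le_traj_pow_traj φ F hk hkN _)
      nlinarith [Nat.le_mul_of_pos_left N hk]

end Inert

section Polynomial

variable [AddCommGroup G]

/-- Evaluation of integral polynomials in `φ` at the element `x`. -/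
noncomputable def evalEnd (φ : AddMonoid.End G) (x : G) : ℤ[X] →+ G where
  toFun p := aeval φ p x
  map_zero' := by simp
  map_add' p q := by
    rw [map_add]
    rfl

theorem evalEnd_X_pow_mul (φ : AddMonoid.End G) (x : G) (i : ℕ) (p : ℤ[X]) :
    evalEnd φ x (X ^ i * p) = (φ ^ i) (evalEnd φ x p) := by
  simp [evalEnd]

theorem evalEnd_monomial (φ : AddMonoid.End G) (x : G) (i : ℕ) (a : ℤ) :
    evalEnd φ x (monomial i a) = a • (φ ^ i) x := by
  have h1 : evalEnd φ x 1 = x := by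
    change aeval φ (1 : ℤ[X]) x = x
    rw [map_one]
    rfl
  have h2 : monomial i a = a • (X ^ i * 1 : ℤ[X]) := by
    simp [X_pow_eq_monomial, smul_monomial, -zsmul_eq_mul]
  rw [h2, map_zsmul, evalEnd_X_pow_mul, h1]

/-- The integral polynomials whose coefficients of degree at least `n` are divisible by `m`. -/
def dvdCoeffs (m n : ℕ) : AddSubgroup ℤ[X] where
  carrier := {p | ∀ i, n ≤ i → (m : ℤ) ∣ p.coeff i}
  zero_mem' := by simp
  add_mem' hp hq i hi := by
    rw [coeff_add]
    exact dvd_add (hp i hi) (hq i hi)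
  neg_mem' hp i hi := by
    rw [coeff_neg]
    exact (hp i hi).neg_right

theorem traj_map_dvdCoeffs_le (φ : AddMonoid.End G) (x : G) (m n : ℕ) :
    traj φ ((dvdCoeffs m 1).map (evalEnd φ x)) n ≤ (dvdCoeffs m n).map (evalEnd φ x) := by
  refine traj_le_iff.2 fun i hi => ?_
  rintro _ ⟨_, ⟨p, hp, rfl⟩, rfl⟩
  refine ⟨X ^ i * p, fun j hj => ?_, evalEnd_X_pow_mul φ x i p⟩
  rw [coeff_X_pow_mul', if_pos (by omega)]
  exact hp _ (by omega)

theorem isInert_map_dvdCoeffs (φ : AddMonoid.End G) (x : G) {m : ℕ} (hm : m ≠ 0) :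
    IsInert φ ((dvdCoeffs m 1).map (evalEnd φ x)) := by
  set K := (dvdCoeffs m 1).map (evalEnd φ x) with hK
  have hB : K.relIndex (AddSubgroup.zmultiples (evalEnd φ x X)) ≠ 0 := by
    refine AddSubgroup.FG.relIndex_ne_zero
      ⟨{evalEnd φ x X}, by simp [AddSubgroup.zmultiples_eq_closure]⟩ hm ?_
    rintro _ ⟨z, rfl⟩
    refine ⟨m • z • X, fun i _ => ?_, by simp only [map_nsmul, map_zsmul]⟩
    rw [coeff_smul, nsmul_eq_mul]
    exact dvd_mul_right _ _
  rw [isInert_iff_relIndex_map_ne_zero]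
  rw [← AddSubgroup.relIndex_sup_left] at hB
  refine AddSubgroup.relIndex_ne_zero_mono ?_ hB
  rintro _ ⟨_, ⟨p, hp, rfl⟩, rfl⟩
  have h1 : evalEnd φ x (X * p - p.coeff 0 • X) ∈ K := by
    refine ⟨_, fun i hi => ?_, rfl⟩
    obtain ⟨j, rfl⟩ := Nat.exists_eq_add_of_le' hi
    rw [coeff_sub, coeff_X_mul, coeff_smul, coeff_X]
    rcases j.eq_zero_or_pos with rfl | hj
    · simp
    · rw [if_neg (by omega)]
      simpa using hp j hj
  refine AddSubgroup.mem_sup.2 ⟨_, h1, p.coeff 0 • evalEnd φ x X, ⟨_, rfl⟩, ?_⟩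
  rw [map_sub, map_zsmul, sub_add_cancel]
  have h2 := evalEnd_X_pow_mul φ x 1 p
  rwa [pow_one, pow_one] at h2

theorem IsInert.log_le_entWrt {φ : AddMonoid.End G} {K : AddSubgroup G} (hK : IsInert φ K)
    {m : ℕ} (hm : 0 < m)
    (h : ∀ n, m ≤ (traj φ K (n + 1)).relIndex (traj φ K (n + 2))) :
    Real.log m ≤ entWrt φ K := by
  have h1 := hK.tendsto_log_relIndex_traj one_pos 1
  rw [Nat.cast_one, one_mul] at h1
  refine ge_of_tendsto h1 ?_
  filter_upwards [eventually_gt_atTop 0] with n hn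
  rw [le_div_iff₀ (by exact_mod_cast hn), one_mul, hK.log_relIndex_traj]
  have h2 : ∀ i ∈ Finset.range n, Real.log m ≤
      Real.log ((traj φ K (i + 1)).relIndex (traj φ K (i + 2))) := fun i _ =>
    Real.log_le_log (by exact_mod_cast hm) (by exact_mod_cast h i)
  have h3 := Finset.card_nsmul_le_sum _ _ _ h2
  rw [Finset.card_range, nsmul_eq_mul] at h3
  linarith

theorem log_le_intrinsicEnt {φ : AddMonoid.End G} {x : G}
    (hx : Function.Injective (evalEnd φ x)) {m : ℕ} (hm : 0 < m) :
    ENNReal.ofReal (Real.log m) ≤ intrinsicEnt φ := by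
  have hK := isInert_map_dvdCoeffs φ x hm.ne'
  set K := (dvdCoeffs m 1).map (evalEnd φ x)
  refine le_iSup₂_of_le K hK (ENNReal.ofReal_le_ofReal (hK.log_le_entWrt hm fun n => ?_))
  have hr := hK.relIndex_traj_succ_ne_zero n
  set r := (traj φ K (n + 1)).relIndex (traj φ K (n + 2))
  have hX : evalEnd φ x (X ^ (n + 1)) ∈ traj φ K (n + 2) := by
    refine map_pow_le_traj φ K (n + 1).lt_succ_self ⟨evalEnd φ x 1, ⟨1, fun i hi => ?_, rfl⟩, ?_⟩
    · rw [coeff_one, if_neg (by omega)]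
      exact dvd_zero _
    · exact (evalEnd_X_pow_mul φ x (n + 1) 1).symm.trans (by rw [mul_one])
  have hrX : r • evalEnd φ x (X ^ (n + 1)) ∈ traj φ K (n + 1) :=
    AddSubgroup.nsmul_relIndex_mem _ hX
  obtain ⟨p, hp, hpx⟩ := traj_map_dvdCoeffs_le φ x m (n + 1) hrX
  rw [← map_nsmul] at hpx
  have hpr := hp (n + 1) le_rfl
  rw [hx hpx, coeff_smul, coeff_X_pow_self, nsmul_one] at hpr
  exact Nat.le_of_dvd (Nat.pos_of_ne_zero hr) (by exact_mod_cast hpr)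

theorem exists_aeval_apply_eq_zero {φ : AddMonoid.End G} (hfin : intrinsicEnt φ < ⊤) (x : G) :
    ∃ p : ℤ[X], p ≠ 0 ∧ aeval φ p x = 0 := by
  by_contra! hcon
  have hx : Function.Injective (evalEnd φ x) :=
    (injective_iff_map_eq_zero _).2 fun p hp => by_contra fun h => hcon p h hp
  have hlim : Tendsto (fun m : ℕ => ENNReal.ofReal (Real.log m)) atTop (𝓝 ⊤) :=
    ENNReal.tendsto_ofReal_atTop.comp (Real.tendsto_log_atTop.comp tendsto_natCast_atTop_atTop)
  refine hfin.not_ge (le_of_tendsto hlim ?_)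
  filter_upwards [eventually_gt_atTop 0] with m hm
  exact log_le_intrinsicEnt hx hm

theorem exists_aeval_eq_zero {φ : AddMonoid.End G} (hfin : intrinsicEnt φ < ⊤)
    {F : AddSubgroup G} (hF : F.FG) (hGF : trajAll φ F = ⊤) :
    ∃ p : ℤ[X], p ≠ 0 ∧ ∀ x, aeval φ p x = 0 := by
  obtain ⟨s, rfl⟩ := hF
  choose P hP0 hP using exists_aeval_apply_eq_zero hfin
  set p := ∏ x ∈ s, P x
  refine ⟨p, Finset.prod_ne_zero_iff.2 fun x _ => hP0 x, fun x => ?_⟩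
  let f : G →+ G := aeval φ p
  suffices h : trajAll φ (AddSubgroup.closure (s : Set G)) ≤ f.ker from
    h (hGF ▸ AddSubgroup.mem_top x)
  refine le_trajAll_iff.2 fun i => AddSubgroup.map_le_iff_le_comap.2 ?_
  refine (AddSubgroup.closure_le _).2 fun y hy => ?_
  obtain ⟨q, hq⟩ : P y ∣ p := Finset.dvd_prod_of_mem P hy
  show aeval φ p ((φ ^ i) y) = 0
  have h1 : aeval φ p ((φ ^ i) y) = aeval φ (p * X ^ i) y := by simp
  have h2 : aeval φ (q * X ^ i * P y) y = aeval φ (q * X ^ i) (aeval φ (P y) y) := by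
    rw [map_mul (aeval φ) (q * X ^ i)]
    rfl
  rw [h1, hq, show P y * q * X ^ i = q * X ^ i * P y by ring, h2, hP, map_zero]

theorem exists_isInert_traj {φ : AddMonoid.End G} (hfin : intrinsicEnt φ < ⊤)
    {F : AddSubgroup G} (hF : F.FG) (hGF : trajAll φ F = ⊤) :
    ∃ d, ∀ N, d ≤ N → IsInert φ (traj φ F N) := by
  obtain ⟨p, hp0, hp⟩ := exists_aeval_eq_zero hfin hF hGF
  refine ⟨p.natDegree, fun N hN => ?_⟩
  set H := traj φ F N with hH
  have hB : H.relIndex (F.map (φ ^ N)) ≠ 0 := by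
    refine (hF.map (φ ^ N)).relIndex_ne_zero (m := p.leadingCoeff.natAbs)
      (Int.natAbs_ne_zero.2 (leadingCoeff_ne_zero.2 hp0)) ?_
    rintro _ ⟨y, hy, rfl⟩
    set z := (φ ^ (N - p.natDegree)) y
    have hzi : ∀ i, (φ ^ i) z = (φ ^ (i + (N - p.natDegree))) y := fun i => by
      rw [pow_add]
      rfl
    have h1 : evalEnd φ z p = 0 := hp z
    rw [p.as_sum_range, map_sum, Finset.sum_range_succ] at h1
    have h2 : p.leadingCoeff • (φ ^ N) y ∈ H := by
      have h3 := evalEnd_monomial φ z p.natDegree p.leadingCoeff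
      rw [hzi, Nat.add_sub_cancel' hN] at h3
      rw [← h3, ← neg_mem_iff, leadingCoeff, ← eq_neg_of_add_eq_zero_left h1]
      refine sum_mem fun i hi => ?_
      rw [evalEnd_monomial, hzi]
      have hi' := Finset.mem_range.1 hi
      exact zsmul_mem (map_pow_le_traj φ F (by omega) ⟨y, hy, rfl⟩) _
    rw [← natCast_zsmul]
    rcases Int.natAbs_eq p.leadingCoeff with h | h
    · rwa [← h]
    · rw [h, neg_smul, neg_mem_iff] at h2
      exact h2
  rw [isInert_iff_relIndex_map_ne_zero]
  rw [← AddSubgroup.relIndex_sup_left] at hB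
  refine AddSubgroup.relIndex_ne_zero_mono ?_ hB
  exact le_sup_right.trans ((traj_succ φ F N).ge.trans (traj_succ' φ F N).le)

end Polynomial

/-- The Logarithmic Law in the special case `G = T(φ,F)` with `F` finitely generated and
`ent̃(φ) < ∞`: there is a finitely generated subgroup `H`, both `φ`-inert and `φ^k`-inert,
with `G = T(φ,H) = T(φ^k,H)`, `ent̃(φ) = ent̃(φ,H)` and `ent̃(φ^k) = ent̃(φ^k,H)`;
consequently `ent̃(φ^k) = k · ent̃(φ)`. -/
theorem logarithmic_law_of_fg [AddCommGroup G] (φ : AddMonoid.End G) (k : ℕ) (hk : 0 < k)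
    (F : AddSubgroup G) (hF : F.FG) (hGF : trajAll φ F = ⊤)
    (hfin : intrinsicEnt φ < ⊤) :
    (∃ H : AddSubgroup G, H.FG ∧ IsInert φ H ∧ IsInert (φ ^ k) H ∧
        trajAll φ H = ⊤ ∧ trajAll (φ ^ k) H = ⊤ ∧
        intrinsicEnt φ = ENNReal.ofReal (entWrt φ H) ∧
        intrinsicEnt (φ ^ k) = ENNReal.ofReal (entWrt (φ ^ k) H)) ∧
      intrinsicEnt (φ ^ k) = (k : ℝ≥0∞) * intrinsicEnt φ := by
  obtain ⟨d, hd⟩ := exists_isInert_traj hfin hF hGF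
  have hkN : k ≤ d + k := Nat.le_add_left k d
  have hH : IsInert φ (traj φ F (d + k)) := hd _ (Nat.le_add_right d k)
  have hfg := traj_fg φ hF (d + k)
  have htop := trajAll_traj_eq_top (hk.trans_le hkN) hGF
  have htopk := trajAll_pow_eq_top hk hkN hGF
  have h1 := hH.intrinsicEnt_eq hfg htop
  have h2 := (hH.pow k).intrinsicEnt_eq hfg htopk
  refine ⟨⟨_, hfg, hH, hH.pow k, htop, htopk, h1, h2⟩, ?_⟩
  rw [h1, h2, entWrt_pow hk hkN hH, ENNReal.ofReal_mul k.cast_nonneg, ENNReal.ofReal_natCast]
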